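/- Let n ≥ 1, let f : ℝⁿ → ℝ be smooth, fix x₀ ∈ ℝⁿ, R ≥ 2, K ≥ 0, t₀ ∈ ℝ, T > 0, a < 0 and 0 < δ ≤ D. Assume ⟨Hess f(x) v, v⟩ ≥ −(n−1)K|v|² for all x in the ball B(x₀,R) and all v ∈ ℝⁿ, and let u be a smooth function on Q_{R,T} = B(x₀,R) × [t₀−T,t₀] with δ ≤ u ≤ D solving the nonlinear f-heat equation ∂u/∂t = Δ_f u + a·u·ln u. Then there exists a constant c depending only on n such that for all (x,t) ∈ B(x₀,R/2) × (t₀−T, t₀], |∇u|(x,t)/√(u(x,t)) ≤ c·√D·( 1/R + √(|α|/R) + 1/√(t−t₀+T) + √K + √(c₂) ), where c₂ = max{2(n−1)K + a(2 + ln δ), 0} and α = max_{|x−x₀|=1} ( (n−1) − ⟨∇f(x), x−x₀⟩ ). (This is the Euclidean-space case of the paper's Theorem 1.1(ii).) -/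

import Mathlib

open Metric Set
open scoped RealInnerProductSpace

noncomputable section

/-- Euclidean Laplacian on `EuclideanSpace ℝ (Fin n)`. -/
def eLap {n : ℕ} (u : EuclideanSpace ℝ (Fin n) → ℝ) (x : EuclideanSpace ℝ (Fin n)) : ℝ :=
  ∑ i : Fin n,
    fderiv ℝ (fun y => fderiv ℝ u y (EuclideanSpace.single i 1)) x (EuclideanSpace.single i 1)

/-- Weighted (drift) Laplacian `Δ_f u = Δu − ⟨∇f, ∇u⟩`. -/
def fLap {n : ℕ} (f u : EuclideanSpace ℝ (Fin n) → ℝ) (x : EuclideanSpace ℝ (Fin n)) : ℝ :=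
  eLap u x - ⟪gradient f x, gradient u x⟫

/-- Hessian quadratic form of `f` at `x` evaluated at `(v, v)`. -/
def hessQF {n : ℕ} (f : EuclideanSpace ℝ (Fin n) → ℝ) (x v : EuclideanSpace ℝ (Fin n)) : ℝ :=
  fderiv ℝ (fun y => fderiv ℝ f y v) x v

/-- The constant `α = max_{|x−x₀|=1} ((n−1) − ⟨∇f(x), x−x₀⟩)`. -/
def alphaC {n : ℕ} (f : EuclideanSpace ℝ (Fin n) → ℝ) (x₀ : EuclideanSpace ℝ (Fin n)) : ℝ :=
  sSup ((fun y => (n : ℝ) - 1 - ⟪gradient f y, y - x₀⟫) '' sphere x₀ 1)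


open Filter Topology

namespace Ham

/-- directional derivative on a normed space -/
def dd {V : Type*} [NormedAddCommGroup V] [NormedSpace ℝ V] (v : V) (g : V → ℝ) : V → ℝ :=
  fun p => fderiv ℝ g p v

section dcalc
variable {V : Type*} [NormedAddCommGroup V] [NormedSpace ℝ V]

lemma dd_contDiffOn {k m : WithTop ℕ∞} (v : V) {g : V → ℝ} {O : Set V} (hO : IsOpen O)
    (hg : ContDiffOn ℝ k g O) (h : m + 1 ≤ k) : ContDiffOn ℝ m (dd v g) O :=
  (hg.fderiv_of_isOpen hO h).clm_apply contDiffOn_const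

lemma dd_comm (v w : V) {g : V → ℝ} {p : V} (hg : ContDiffAt ℝ 2 g p) :
    dd v (dd w g) p = dd w (dd v g) p := by
  have h := hg.isSymmSndFDerivAt (by simp)
  have hd : DifferentiableAt ℝ (fderiv ℝ g) p :=
    (hg.fderiv_right (m := 1) (by norm_num)).differentiableAt (by norm_num)
  have e : ∀ z : V, fderiv ℝ (dd z g) p = (fderiv ℝ (fderiv ℝ g) p).flip z := by
    intro z
    unfold dd
    rw [fderiv_clm_apply hd (differentiableAt_const z)]
    ext y
    simp
  change fderiv ℝ (dd w g) p v = fderiv ℝ (dd v g) p w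
  rw [e, e]
  exact h v w

lemma dd_congr (v : V) {g h : V → ℝ} {O : Set V} (hO : IsOpen O) (e : EqOn g h O) :
    EqOn (dd v g) (dd v h) O := by
  intro p hp
  have : g =ᶠ[𝓝 p] h := by
    filter_upwards [hO.mem_nhds hp] with q hq using e hq
  unfold dd
  rw [this.fderiv_eq]

lemma dd_mul (v : V) {g h : V → ℝ} {p : V} (hg : DifferentiableAt ℝ g p)
    (hh : DifferentiableAt ℝ h p) :
    dd v (fun q => g q * h q) p = dd v g p * h p + g p * dd v h p := by
  unfold dd
  rw [fderiv_fun_mul hg hh]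
  simp
  ring

lemma dd_add (v : V) {g h : V → ℝ} {p : V} (hg : DifferentiableAt ℝ g p)
    (hh : DifferentiableAt ℝ h p) :
    dd v (fun q => g q + h q) p = dd v g p + dd v h p := by
  unfold dd
  rw [fderiv_fun_add hg hh]
  simp

lemma dd_sub (v : V) {g h : V → ℝ} {p : V} (hg : DifferentiableAt ℝ g p)
    (hh : DifferentiableAt ℝ h p) :
    dd v (fun q => g q - h q) p = dd v g p - dd v h p := by
  unfold dd
  rw [fderiv_fun_sub hg hh]
  simp

lemma dd_sum {ι : Type*} (s : Finset ι) (v : V) {g : ι → V → ℝ} {p : V}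
    (hg : ∀ i ∈ s, DifferentiableAt ℝ (g i) p) :
    dd v (fun q => ∑ i ∈ s, g i q) p = ∑ i ∈ s, dd v (g i) p := by
  unfold dd
  rw [fderiv_fun_sum hg]
  simp

lemma dd_comp (v : V) {φ : ℝ → ℝ} {φ' : ℝ} {g : V → ℝ} {p : V} (hφ : HasDerivAt φ φ' (g p))
    (hg : DifferentiableAt ℝ g p) :
    dd v (fun q => φ (g q)) p = φ' * dd v g p := by
  unfold dd
  have := (hφ.comp_hasFDerivAt p hg.hasFDerivAt).fderiv
  have e : (φ ∘ g) = fun q => φ (g q) := rfl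
  rw [e] at this
  rw [this]
  simp

lemma dd_hasDerivAt (v : V) {g : V → ℝ} {p : V} {τ : ℝ}
    (hg : DifferentiableAt ℝ g (p + τ • v)) :
    HasDerivAt (fun τ : ℝ => g (p + τ • v)) (dd v g (p + τ • v)) τ := by
  have h1 : HasDerivAt (fun τ : ℝ => p + τ • v) v τ := by
    simpa using ((hasDerivAt_id τ).smul_const v).const_add p
  exact hg.hasFDerivAt.comp_hasDerivAt τ h1

/-- necessary conditions at an interior maximum -/
lemma dd_max (v : V) {g : V → ℝ} {p : V} {O : Set V} (hO : IsOpen O) (hp : p ∈ O)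
    (hg : ContDiffOn ℝ 2 g O) (hmax : ∀ τ : ℝ, p + τ • v ∈ O → g (p + τ • v) ≤ g p) :
    dd v g p = 0 ∧ dd v (dd v g) p ≤ 0 := by
  have hcont : Continuous (fun τ : ℝ => p + τ • v) := by fun_prop
  have h0 : p + (0:ℝ) • v = p := by simp
  have hev : ∀ᶠ τ : ℝ in 𝓝 0, p + τ • v ∈ O := by
    apply hcont.continuousAt.eventually_mem
    rw [h0]; exact hO.mem_nhds hp
  have hd1 : ∀ q ∈ O, DifferentiableAt ℝ g q := fun q hq =>
    (hg.contDiffAt (hO.mem_nhds hq)).differentiableAt (by norm_num)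
  have hd2 : ∀ q ∈ O, DifferentiableAt ℝ (dd v g) q := fun q hq =>
    ((dd_contDiffOn (m := 1) v hO hg (by norm_num)).contDiffAt (hO.mem_nhds hq)).differentiableAt
      (by norm_num)
  have hlm : IsLocalMax (fun τ : ℝ => g (p + τ • v)) 0 := by
    filter_upwards [hev] with τ hτ
    simpa using hmax τ hτ
  have hder : ∀ᶠ τ : ℝ in 𝓝 0, HasDerivAt (fun τ : ℝ => g (p + τ • v)) (dd v g (p + τ • v)) τ := by
    filter_upwards [hev] with τ hτ using dd_hasDerivAt v (hd1 _ hτ)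
  have hder2 : HasDerivAt (fun τ : ℝ => dd v g (p + τ • v)) (dd v (dd v g) p) 0 := by
    have := dd_hasDerivAt (τ := 0) v (p := p) (g := dd v g) (by rw [h0]; exact hd2 p hp)
    rwa [h0] at this
  have hz : dd v g p = 0 := by
    have := hlm.hasDerivAt_eq_zero hder.self_of_nhds
    rwa [h0] at this
  refine ⟨hz, ?_⟩
  by_contra! hpos
  have hde : deriv (fun τ : ℝ => g (p + τ • v)) =ᶠ[𝓝 0] fun τ => dd v g (p + τ • v) := by
    filter_upwards [hder] with τ hτ using hτ.deriv
  have hdd : deriv (deriv (fun τ : ℝ => g (p + τ • v))) 0 = dd v (dd v g) p := by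
    rw [hde.deriv_eq, hder2.deriv]
  have hmin : IsLocalMin (fun τ : ℝ => g (p + τ • v)) 0 := by
    apply isLocalMin_of_deriv_deriv_pos
    · rw [hdd]; exact hpos
    · rw [hde.self_of_nhds]; simp only [h0, hz]
    · exact hder.self_of_nhds.continuousAt
  have hconst : (fun τ : ℝ => g (p + τ • v)) =ᶠ[𝓝 0] fun _ => g p := by
    filter_upwards [hmin, hlm] with τ h1 h2
    simp only [h0] at h1 h2
    exact le_antisymm h2 h1
  have : deriv (fun τ : ℝ => g (p + τ • v)) =ᶠ[𝓝 0] deriv (fun _ => g p) := hconst.deriv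
  rw [this.deriv_eq] at hdd
  simp at hdd
  linarith

/-- one-sided necessary condition -/
lemma dd_max_left (v : V) {g : V → ℝ} {p : V} {O : Set V} (hO : IsOpen O) (hp : p ∈ O)
    (hg : DifferentiableAt ℝ g p) (hmax : ∀ τ : ℝ, τ ≤ 0 → p + τ • v ∈ O → g (p + τ • v) ≤ g p) :
    0 ≤ dd v g p := by
  have hcont : Continuous (fun τ : ℝ => p + τ • v) := by fun_prop
  have h0 : p + (0:ℝ) • v = p := by simp
  have hev : ∀ᶠ τ : ℝ in 𝓝 0, p + τ • v ∈ O := by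
    apply hcont.continuousAt.eventually_mem
    rw [h0]; exact hO.mem_nhds hp
  have hder : HasDerivAt (fun τ : ℝ => g (p + τ • v)) (dd v g p) 0 := by
    have := dd_hasDerivAt (τ := 0) v (p := p) (g := g) (by rw [h0]; exact hg)
    rwa [h0] at this
  have h1 := (hasDerivWithinAt_iff_tendsto_slope' (s := Iio 0) (by simp)).1
    (hder.hasDerivWithinAt (s := Iio 0))
  apply ge_of_tendsto h1
  filter_upwards [self_mem_nhdsWithin, nhdsWithin_le_nhds hev] with τ hτ hτO
  have hτ' : τ < 0 := hτ
  have := hmax τ hτ'.le hτO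
  rw [slope_def_field]
  apply div_nonneg_of_nonpos
  · simp only [h0]; linarith
  · linarith

end dcalc

lemma alg_core {n : ℕ} (U F Ft Ut a l k : ℝ) (ui fi Fi Fii Utj : Fin n → ℝ)
    (uij fij uiij : Fin n → Fin n → ℝ) (hU : 0 < U)
    (h1 : ∀ i, ∑ j, 2 * (ui j * uij i j) = ui i * F + U * Fi i)
    (h2 : ∑ i, ∑ j, 2 * (uij i j ^ 2 + ui j * uiij i j)
      ≤ ∑ i, (uij i i * F + 2 * (ui i * Fi i) + U * Fii i))
    (h3 : Ut * F + U * Ft ≤ ∑ j, 2 * (ui j * Utj j))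
    (h4 : ∀ j, Utj j = ∑ i, uiij i j - ∑ i, (fij i j * ui i + fi i * uij i j)
      + a * (l + 1) * ui j)
    (h5 : Ut = ∑ i, uij i i - ∑ i, fi i * ui i + a * U * l)
    (h6 : ∑ j, ui j ^ 2 = U * F)
    (hess : -k * ∑ j, ui j ^ 2 ≤ ∑ i, ∑ j, fij i j * ui i * ui j) :
    F ^ 2 / 2 ≤ (2 * k + a * (l + 2)) * (U * F) + ∑ i, ui i * Fi i
      + U * (∑ i, Fii i - ∑ i, fi i * Fi i - Ft) := by
  -- Hessian square
  have hsq : 0 ≤ ∑ i, ∑ j, (uij i j - ui i * ui j / (2 * U)) ^ 2 :=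
    Finset.sum_nonneg fun i _ => Finset.sum_nonneg fun j _ => sq_nonneg _
  have hsq2 : ∑ i, ∑ j, (uij i j - ui i * ui j / (2 * U)) ^ 2
      = ∑ i, ∑ j, uij i j ^ 2 - (1 / (2 * U)) * ∑ i, ui i * ∑ j, 2 * (ui j * uij i j)
        + (1 / (2 * U)) ^ 2 * ((∑ i, ui i ^ 2) * ∑ j, ui j ^ 2) := by
    rw [Finset.sum_mul_sum]
    simp only [Finset.mul_sum, ← Finset.sum_sub_distrib, ← Finset.sum_add_distrib]
    refine Finset.sum_congr rfl fun i _ => Finset.sum_congr rfl fun j _ => ?_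
    ring
  have hA : ∑ i, ui i * ∑ j, 2 * (ui j * uij i j) = F * (U * F) + U * ∑ i, ui i * Fi i := by
    rw [← h6, Finset.mul_sum, Finset.mul_sum, ← Finset.sum_add_distrib]
    refine Finset.sum_congr rfl fun i _ => ?_
    rw [h1]; ring
  rw [hsq2, hA, h6] at hsq
  have hsq3 : F ^ 2 / 4 + (∑ i, ui i * Fi i) / 2 ≤ ∑ i, ∑ j, uij i j ^ 2 := by
    have : (1 / (2 * U)) * (F * (U * F) + U * ∑ i, ui i * Fi i)
        - (1 / (2 * U)) ^ 2 * (U * F * (U * F)) = F ^ 2 / 4 + (∑ i, ui i * Fi i) / 2 := by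
      field_simp; ring
    linarith
  have hB : ∑ j, 2 * (ui j * Utj j) = ∑ i, ∑ j, 2 * (ui j * uiij i j)
      - 2 * ∑ i, ∑ j, fij i j * ui i * ui j
      - ∑ i, fi i * ∑ j, 2 * (ui j * uij i j) + 2 * a * (l + 1) * ∑ j, ui j ^ 2 := by
    have e1 : ∑ j, 2 * (ui j * Utj j) = ∑ j, (∑ i, (2 * (ui j * uiij i j)
      - 2 * (fij i j * ui i * ui j) - fi i * (2 * (ui j * uij i j))) 
        + 2 * a * (l + 1) * ui j ^ 2) := by
      refine Finset.sum_congr rfl fun j _ => ?_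
      rw [h4 j, ← Finset.sum_sub_distrib, mul_add, mul_add, Finset.mul_sum, Finset.mul_sum]
      congr 1
      · refine Finset.sum_congr rfl fun i _ => ?_
        ring
      · ring
    rw [e1, Finset.sum_add_distrib, Finset.sum_comm]
    simp only [Finset.mul_sum, ← Finset.sum_sub_distrib]
  have hC : ∑ i, fi i * ∑ j, 2 * (ui j * uij i j)
      = F * ∑ i, fi i * ui i + U * ∑ i, fi i * Fi i := by
    rw [Finset.mul_sum, Finset.mul_sum, ← Finset.sum_add_distrib]
    refine Finset.sum_congr rfl fun i _ => ?_
    rw [h1]; ring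
  have hD : ∑ i, ∑ j, 2 * (uij i j ^ 2 + ui j * uiij i j)
      = 2 * ∑ i, ∑ j, uij i j ^ 2 + ∑ i, ∑ j, 2 * (ui j * uiij i j) := by
    simp only [Finset.mul_sum, ← Finset.sum_add_distrib]
    refine Finset.sum_congr rfl fun i _ => Finset.sum_congr rfl fun j _ => ?_
    ring
  have hE : ∑ i, (uij i i * F + 2 * (ui i * Fi i) + U * Fii i)
      = F * ∑ i, uij i i + 2 * ∑ i, ui i * Fi i + U * ∑ i, Fii i := by
    simp only [Finset.mul_sum, ← Finset.sum_add_distrib]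
    refine Finset.sum_congr rfl fun i _ => ?_
    ring
  rw [hD, hE] at h2
  rw [hB, hC, h6] at h3
  rw [h6] at hess
  rw [h5] at h3
  nlinarith

section core
variable {V : Type*} [NormedAddCommGroup V] [NormedSpace ℝ V]

lemma core {n : ℕ} {O : Set V} (hO : IsOpen O) {p : V} (hp : p ∈ O) (e : Fin n → V) (et : V)
    {U fh F : V → ℝ} {a k : ℝ} (hU : ContDiffOn ℝ 3 U O) (hf : ContDiffOn ℝ 3 fh O)
    (hF : ContDiffOn ℝ 2 F O) (hpos : ∀ q ∈ O, 0 < U q)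
    (pde : ∀ q ∈ O, dd et U q = ∑ i, dd (e i) (dd (e i) U) q
      - ∑ i, dd (e i) fh q * dd (e i) U q + a * (U q * Real.log (U q)))
    (heq : ∑ j, dd (e j) U p ^ 2 = U p * F p)
    (hx : ∀ i, ∀ τ : ℝ, p + τ • e i ∈ O →
      ∑ j, dd (e j) U (p + τ • e i) ^ 2 ≤ U (p + τ • e i) * F (p + τ • e i))
    (ht : ∀ τ : ℝ, τ ≤ 0 → p + τ • et ∈ O →
      ∑ j, dd (e j) U (p + τ • et) ^ 2 ≤ U (p + τ • et) * F (p + τ • et))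
    (hess : -k * ∑ j, dd (e j) U p ^ 2
      ≤ ∑ i, ∑ j, dd (e j) (dd (e i) fh) p * dd (e i) U p * dd (e j) U p) :
    F p ^ 2 / 2 ≤ (2 * k + a * (Real.log (U p) + 2)) * (U p * F p)
      + ∑ i, dd (e i) U p * dd (e i) F p
      + U p * (∑ i, dd (e i) (dd (e i) F) p - ∑ i, dd (e i) fh p * dd (e i) F p - dd et F p) := by
  have hU2 : ∀ v, ContDiffOn ℝ 2 (dd v U) O := fun v => dd_contDiffOn v hO hU (by norm_num)
  have hU1 : ∀ v w, ContDiffOn ℝ 1 (dd v (dd w U)) O :=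
    fun v w => dd_contDiffOn v hO (hU2 w) (by norm_num)
  have hf2 : ∀ v, ContDiffOn ℝ 2 (dd v fh) O := fun v => dd_contDiffOn v hO hf (by norm_num)
  have hF1 : ∀ v, ContDiffOn ℝ 1 (dd v F) O := fun v => dd_contDiffOn v hO hF (by norm_num)
  have D : ∀ {g : V → ℝ} {m : WithTop ℕ∞}, ContDiffOn ℝ m g O → m ≠ 0 → ∀ q ∈ O,
      DifferentiableAt ℝ g q := fun hg hm q hq =>
    (hg.contDiffAt (hO.mem_nhds hq)).differentiableAt hm
  have dU := D hU (by norm_num)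
  have dF := D hF (by norm_num)
  have dUi : ∀ v, ∀ q ∈ O, DifferentiableAt ℝ (dd v U) q := fun v => D (hU2 v) (by norm_num)
  have dfi : ∀ v, ∀ q ∈ O, DifferentiableAt ℝ (dd v fh) q := fun v => D (hf2 v) (by norm_num)
  have dFi : ∀ v, ∀ q ∈ O, DifferentiableAt ℝ (dd v F) q := fun v => D (hF1 v) (by norm_num)
  have dUij : ∀ v w, ∀ q ∈ O, DifferentiableAt ℝ (dd v (dd w U)) q :=
    fun v w => D (hU1 v w) (by norm_num)
  -- the comparison function
  set G : V → ℝ := fun q => ∑ j, dd (e j) U q * dd (e j) U q - U q * F q with hGdef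
  have hG : ContDiffOn ℝ 2 G O := by
    apply ContDiffOn.sub
    · exact ContDiffOn.sum fun j _ => (hU2 _).mul (hU2 _)
    · exact (hU.of_le (by norm_num)).mul hF
  have hG0 : G p = 0 := by
    simp only [hGdef, ← pow_two]; rw [heq]; ring
  have hGd : ∀ v, ∀ q ∈ O, dd v G q = ∑ j, 2 * (dd (e j) U q * dd v (dd (e j) U) q)
      - (dd v U q * F q + U q * dd v F q) := by
    intro v q hq
    rw [hGdef, dd_sub v _ ((dU q hq).fun_mul (dF q hq)), dd_mul v (dU q hq) (dF q hq), dd_sum]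
    · congr 1
      refine Finset.sum_congr rfl fun j _ => ?_
      rw [dd_mul v (dUi _ q hq) (dUi _ q hq)]; ring
    · intro j _; exact (dUi _ q hq).mul (dUi _ q hq)
    · exact DifferentiableAt.fun_sum fun j _ => (dUi _ q hq).mul (dUi _ q hq)
  have hGdd : ∀ v, dd v (dd v G) p = ∑ j, 2 * (dd v (dd (e j) U) p ^ 2
        + dd (e j) U p * dd v (dd v (dd (e j) U)) p)
      - (dd v (dd v U) p * F p + 2 * (dd v U p * dd v F p) + U p * dd v (dd v F) p) := by
    intro v
    rw [dd_congr v hO (hGd v) hp]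
    have c1 : ∀ j, DifferentiableAt ℝ (fun q => 2 * (dd (e j) U q * dd v (dd (e j) U) q)) p :=
      fun j => ((dUi _ p hp).mul (dUij _ _ p hp)).const_mul 2
    have c2 := (dUi v p hp).fun_mul (dF p hp)
    have c3 := (dU p hp).fun_mul (dFi v p hp)
    rw [dd_sub v (DifferentiableAt.fun_sum fun j _ => c1 j) (c2.fun_add c3), dd_sum _ _ fun j _ => c1 j,
      dd_add v c2 c3, dd_mul v (dUi v p hp) (dF p hp), dd_mul v (dU p hp) (dFi v p hp)]
    congr 1
    · refine Finset.sum_congr rfl fun j _ => ?_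
      rw [dd_mul v (differentiableAt_const 2) ((dUi _ p hp).fun_mul (dUij _ _ p hp)),
        dd_mul v (dUi _ p hp) (dUij _ _ p hp)]
      simp [dd]; ring
    · ring
  have hm : ∀ i, dd (e i) G p = 0 ∧ dd (e i) (dd (e i) G) p ≤ 0 := by
    intro i
    apply dd_max (e i) hO hp hG
    intro τ hτ
    rw [hG0]
    have := hx i τ hτ
    simp only [hGdef, ← pow_two]; linarith
  have hmt : 0 ≤ dd et G p := by
    apply dd_max_left et hO hp (D hG (by norm_num) p hp)
    intro τ h0 hτ
    rw [hG0]
    have := ht τ h0 hτ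
    simp only [hGdef, ← pow_two]; linarith
  have A2 : ∀ q ∈ O, ContDiffAt ℝ 2 U q := fun q hq =>
    (hU.contDiffAt (hO.mem_nhds hq)).of_le (by norm_num)
  apply alg_core (U p) (F p) (dd et F p) (dd et U p) a (Real.log (U p)) k
    (fun i => dd (e i) U p) (fun i => dd (e i) fh p) (fun i => dd (e i) F p)
    (fun i => dd (e i) (dd (e i) F) p) (fun j => dd et (dd (e j) U) p)
    (fun i j => dd (e i) (dd (e j) U) p) (fun i j => dd (e j) (dd (e i) fh) p)
    (fun i j => dd (e i) (dd (e i) (dd (e j) U)) p) (hpos p hp)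
  · intro i
    have := (hm i).1
    rw [hGd _ p hp] at this
    linarith
  · rw [← sub_nonpos, ← Finset.sum_sub_distrib]
    apply Finset.sum_nonpos
    intro i _
    have := (hm i).2
    rw [hGdd] at this
    exact this
  · rw [hGd _ p hp] at hmt
    linarith
  · intro j
    change dd et (dd (e j) U) p = _
    rw [dd_comm et (e j) (A2 p hp), dd_congr (e j) hO (fun q hq => pde q hq) hp]
    have c1 : ∀ i, DifferentiableAt ℝ (dd (e i) (dd (e i) U)) p := fun i => dUij _ _ p hp
    have c2 : ∀ i, DifferentiableAt ℝ (fun q => dd (e i) fh q * dd (e i) U q) p :=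
      fun i => (dfi _ p hp).fun_mul (dUi _ p hp)
    have hne := (hpos p hp).ne'
    have c3 : DifferentiableAt ℝ (fun q => Real.log (U q)) p := (dU p hp).log hne
    have c4 : DifferentiableAt ℝ (fun q => a * (U q * Real.log (U q))) p :=
      ((dU p hp).fun_mul c3).const_mul a
    have c5 := DifferentiableAt.fun_sum (u := Finset.univ) fun i _ => c1 i
    have c6 := DifferentiableAt.fun_sum (u := Finset.univ) fun i _ => c2 i
    rw [dd_add _ (c5.fun_sub c6) c4, dd_sub _ c5 c6, dd_sum _ _ fun i _ => c1 i,
      dd_sum _ _ fun i _ => c2 i]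
    congr 1
    · congr 1
      · refine Finset.sum_congr rfl fun i _ => ?_
        have t1 : EqOn (dd (e i) (dd (e j) U)) (dd (e j) (dd (e i) U)) O :=
          fun q hq => dd_comm _ _ (A2 q hq)
        change _ = dd (e i) (dd (e i) (dd (e j) U)) p
        rw [dd_congr (e i) hO t1 hp]
        exact dd_comm _ _ ((hU2 _).contDiffAt (hO.mem_nhds hp))
      · refine Finset.sum_congr rfl fun i _ => ?_
        rw [dd_mul _ (dfi _ p hp) (dUi _ p hp)]
        rw [dd_comm (e i) (e j) (A2 p hp)]
    · rw [dd_mul _ (differentiableAt_const a) ((dU p hp).fun_mul c3), dd_mul _ (dU p hp) c3,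
        dd_comp _ (Real.hasDerivAt_log hne) (dU p hp)]
      simp only [dd, fderiv_const_apply]
      simp
      field_simp
  · rw [pde p hp]; ring
  · exact heq
  · exact hess

end core

/-- cubic cutoff profile -/
def cub (e : ℝ) : ℝ := max e 0 ^ 3

lemma hasDerivAt_maxpow (m : ℕ) (e : ℝ) :
    HasDerivAt (fun e : ℝ => max e 0 ^ (m + 2)) ((m + 2 : ℝ) * max e 0 ^ (m + 1)) e := by
  rcases lt_trichotomy e 0 with h | h | h
  · have : (fun e : ℝ => max e 0 ^ (m + 2)) =ᶠ[𝓝 e] fun _ => 0 := by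
      filter_upwards [Iio_mem_nhds h] with y hy
      have hy' : y < 0 := hy
      simp [max_eq_right hy'.le]
    rw [max_eq_right h.le]
    simpa using (hasDerivAt_const e (0:ℝ)).congr_of_eventuallyEq this
  · subst h
    simp only [max_self]
    rw [hasDerivAt_iff_isLittleO]
    simp only [sub_zero, max_self, ne_eq, Nat.add_eq_zero_iff, OfNat.ofNat_ne_zero, and_false,
      not_false_eq_true, zero_pow, one_ne_zero, mul_zero, smul_zero]
    have h1 : (fun x : ℝ => max x 0 ^ (m + 2)) =O[𝓝 0] fun x : ℝ => x ^ (m + 2) := by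
      apply Asymptotics.IsBigO.of_bound 1
      filter_upwards with x
      rw [norm_pow, norm_pow, one_mul]
      apply pow_le_pow_left₀ (norm_nonneg _)
      rw [Real.norm_eq_abs, Real.norm_eq_abs, abs_of_nonneg (le_max_right _ _)]
      exact max_le (le_abs_self x) (abs_nonneg x)
    refine h1.trans_isLittleO ?_
    have := Asymptotics.isLittleO_pow_id (𝕜 := ℝ) (n := m + 2) (by omega)
    simpa using this
  · have : (fun e : ℝ => max e 0 ^ (m + 2)) =ᶠ[𝓝 e] fun e => e ^ (m + 2) := by
      filter_upwards [Ioi_mem_nhds h] with y hy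
      have hy' : 0 < y := hy
      simp [max_eq_left hy'.le]
    rw [max_eq_left h.le]
    have h2 := (hasDerivAt_pow (m + 2) e).congr_of_eventuallyEq this
    simpa using h2

lemma contDiff_cub : ContDiff ℝ 2 cub := by
  have h3 : deriv cub = fun e => 3 * max e 0 ^ 2 := by
    ext e
    have := (hasDerivAt_maxpow 1 e).deriv
    norm_num at this
    exact this
  have h2 : deriv (fun e : ℝ => max e 0 ^ 2) = fun e => 2 * max e 0 := by
    ext e
    have := (hasDerivAt_maxpow 0 e).deriv
    norm_num at this
    exact this
  have c2 : ContDiff ℝ 1 (fun e : ℝ => max e 0 ^ 2) := by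
    rw [contDiff_one_iff_deriv]
    refine ⟨fun e => (hasDerivAt_maxpow 0 e).differentiableAt, ?_⟩
    rw [h2]; fun_prop
  rw [show (2 : WithTop ℕ∞) = 1 + 1 by norm_num, contDiff_succ_iff_deriv]
  refine ⟨fun e => (hasDerivAt_maxpow 1 e).differentiableAt, by simp, ?_⟩
  rw [h3]
  exact contDiff_const.mul c2

lemma cub_lt_one {e : ℝ} (he : e < 1) : cub e < 1 := by
  have h0 : 0 ≤ max e 0 := le_max_right _ _
  have h1 : max e 0 < 1 := max_lt he one_pos
  exact pow_lt_one₀ h0 h1 (by norm_num)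

/-- blow-up profile -/
def phi (e : ℝ) : ℝ := ((1 - cub e) ^ 2)⁻¹
/-- its derivative -/
def phi1 (e : ℝ) : ℝ := 6 * max e 0 ^ 2 * ((1 - cub e) ^ 3)⁻¹
/-- its second derivative -/
def phi2 (e : ℝ) : ℝ := 12 * max e 0 * ((1 - cub e) ^ 3)⁻¹ + 54 * max e 0 ^ 4 * ((1 - cub e) ^ 4)⁻¹

lemma hasDerivAt_cub (e : ℝ) : HasDerivAt cub (3 * max e 0 ^ 2) e := by
  have := hasDerivAt_maxpow 1 e
  norm_num at this
  exact this

lemma hasDerivAt_phi {e : ℝ} (he : e < 1) : HasDerivAt phi (phi1 e) e := by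
  have h := cub_lt_one he
  have hne : 1 - cub e ≠ 0 := by linarith
  have h1 := (((hasDerivAt_cub e).const_sub 1).pow 2).inv (pow_ne_zero 2 hne)
  refine HasDerivAt.congr_deriv h1 ?_
  unfold phi1
  simp only [Pi.pow_apply]
  field_simp
  norm_num
  ring

lemma hasDerivAt_phi1 {e : ℝ} (he : e < 1) : HasDerivAt phi1 (phi2 e) e := by
  have h := cub_lt_one he
  have hne : 1 - cub e ≠ 0 := by linarith
  have h0 : HasDerivAt (fun e : ℝ => 6 * max e 0 ^ 2) (6 * (2 * max e 0)) e := by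
    have := (hasDerivAt_maxpow 0 e).const_mul 6
    norm_num at this
    exact this
  have h1 := h0.mul ((((hasDerivAt_cub e).const_sub 1).pow 3).inv (pow_ne_zero 3 hne))
  refine HasDerivAt.congr_deriv h1 ?_
  unfold phi2
  simp only [Pi.pow_apply, Pi.inv_apply]
  field_simp
  norm_num
  ring

lemma phi_contDiffOn : ContDiffOn ℝ 2 phi (Iio 1) := by
  unfold phi
  apply ContDiffOn.inv
  · exact ((contDiff_const.sub contDiff_cub).pow 2).contDiffOn
  · intro e he
    have := cub_lt_one he
    apply pow_ne_zero
    linarith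

lemma phi_bounds {e : ℝ} (he : e < 1) : 1 ≤ phi e ∧ 0 ≤ phi1 e ∧ phi1 e ^ 2 ≤ 36 * phi e ^ 3 ∧
    phi1 e ≤ 6 * phi e ^ 2 ∧ phi2 e ≤ 66 * phi e ^ 2 ∧ (e ≤ 0 → phi1 e = 0) := by
  have h := cub_lt_one he
  have hp0 : 0 ≤ max e 0 := le_max_right _ _
  have hp1 : max e 0 ≤ 1 := (max_lt he one_pos).le
  have hc : 0 ≤ cub e := pow_nonneg hp0 3
  have key : 1 ≤ (1 - cub e)⁻¹ := (one_le_inv₀ (by linarith)).2 (by linarith)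
  unfold phi phi1 phi2
  simp only [← inv_pow]
  set y := (1 - cub e)⁻¹
  set p := max e 0 with hp
  have y0 : 0 ≤ y := by linarith
  have hp2 : p ^ 2 ≤ 1 := pow_le_one₀ hp0 hp1
  have hp4 : p ^ 4 ≤ 1 := pow_le_one₀ hp0 hp1
  have y34 : y ^ 3 ≤ y ^ 4 := pow_le_pow_right₀ key (by norm_num)
  have y3 : 0 ≤ y ^ 3 := by positivity
  refine ⟨one_le_pow₀ key, by positivity, ?_, ?_, ?_, ?_⟩
  · have : (6 * p ^ 2 * y ^ 3) ^ 2 = 36 * (y ^ 2) ^ 3 * p ^ 4 := by ring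
    rw [this]
    have : 0 ≤ 36 * (y ^ 2) ^ 3 := by positivity
    nlinarith
  · have : (y ^ 2) ^ 2 = y ^ 4 := by ring
    nlinarith
  · have : (y ^ 2) ^ 2 = y ^ 4 := by ring
    have a1 : p * y ^ 3 ≤ y ^ 4 := by nlinarith
    have a2 : p ^ 4 * y ^ 4 ≤ y ^ 4 := by nlinarith [pow_nonneg y0 4]
    nlinarith
  · intro h
    rw [hp, max_eq_right h]; simp

section barrier
variable {H : Type*} [NormedAddCommGroup H] [InnerProductSpace ℝ H]

/-- the rescaled squared distance -/
def ee (x₀ : H) (R : ℝ) (q : H × ℝ) : ℝ := 2 / R ^ 2 * ⟪q.1 - x₀, q.1 - x₀⟫ - 1 / 2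

lemma ee_contDiff (x₀ : H) (R : ℝ) {m : WithTop ℕ∞} : ContDiff ℝ m (ee x₀ R) := by
  have h : ContDiff ℝ m (fun q : H × ℝ => q.1 - x₀) := by fun_prop
  exact (contDiff_const.mul (h.inner ℝ h)).sub contDiff_const

lemma dd_ee (x₀ : H) (R : ℝ) (v q : H × ℝ) :
    dd v (ee x₀ R) q = 4 / R ^ 2 * ⟪q.1 - x₀, v.1⟫ := by
  have h : HasFDerivAt (fun q : H × ℝ => q.1 - x₀) (ContinuousLinearMap.fst ℝ H ℝ) q := by
    exact (ContinuousLinearMap.fst ℝ H ℝ).hasFDerivAt.sub_const x₀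
  have h2 := ((h.inner ℝ h).const_mul (2 / R ^ 2)).sub_const (1 / 2)
  unfold dd
  have : fderiv ℝ (ee x₀ R) q = _ := h2.fderiv
  rw [this]
  simp [real_inner_comm]
  ring

lemma dd_dd_ee (x₀ : H) (R : ℝ) (v q : H × ℝ) :
    dd v (dd v (ee x₀ R)) q = 4 / R ^ 2 * ⟪v.1, v.1⟫ := by
  have : dd v (ee x₀ R) = fun q => 4 / R ^ 2 * ⟪q.1 - x₀, v.1⟫ := by
    ext q; exact dd_ee x₀ R v q
  rw [this]
  have h : HasFDerivAt (fun q : H × ℝ => q.1 - x₀) (ContinuousLinearMap.fst ℝ H ℝ) q := by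
    exact (ContinuousLinearMap.fst ℝ H ℝ).hasFDerivAt.sub_const x₀
  have h2 := (h.inner ℝ (hasFDerivAt_const v.1 q)).const_mul (4 / R ^ 2)
  unfold dd
  rw [h2.fderiv]
  simp

/-- the barrier -/
def bar (x₀ : H) (R M E s : ℝ) (q : H × ℝ) : ℝ := M * (phi (ee x₀ R q) * (E + (q.2 - s)⁻¹))

/-- the region where the barrier is finite -/
def reg (x₀ : H) (R s : ℝ) : Set (H × ℝ) := {q | ee x₀ R q < 1 ∧ s < q.2}

lemma reg_open (x₀ : H) (R s : ℝ) : IsOpen (reg x₀ R s) := by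
  apply IsOpen.inter
  · exact isOpen_lt (ee_contDiff (m := 0) x₀ R).continuous continuous_const
  · exact isOpen_lt continuous_const continuous_snd

lemma theta_contDiffOn (x₀ : H) (R E s : ℝ) {m : WithTop ℕ∞} :
    ContDiffOn ℝ m (fun q : H × ℝ => E + (q.2 - s)⁻¹) (reg x₀ R s) := by
  apply contDiffOn_const.add
  apply ContDiffOn.inv
  · fun_prop
  · intro q hq
    have := hq.2
    linarith

lemma phiee_contDiffOn (x₀ : H) (R s : ℝ) :
    ContDiffOn ℝ 2 (fun q : H × ℝ => phi (ee x₀ R q)) (reg x₀ R s) :=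
  phi_contDiffOn.comp (ee_contDiff x₀ R).contDiffOn (fun q hq => hq.1)

lemma bar_contDiffOn (x₀ : H) (R M E s : ℝ) :
    ContDiffOn ℝ 2 (bar x₀ R M E s) (reg x₀ R s) :=
  contDiffOn_const.mul ((phiee_contDiffOn x₀ R s).mul (theta_contDiffOn x₀ R E s))

lemma dd_theta (x₀ : H) (R E s : ℝ) (v : H × ℝ) {q : H × ℝ} (hq : q ∈ reg x₀ R s) :
    dd v (fun q : H × ℝ => E + (q.2 - s)⁻¹) q = - ((q.2 - s) ^ 2)⁻¹ * v.2 := by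
  have hne : q.2 - s ≠ 0 := by have := hq.2; linarith
  have h1 : HasDerivAt (fun t : ℝ => E + (t - s)⁻¹) (- ((q.2 - s) ^ 2)⁻¹) q.2 := by
    have := (((hasDerivAt_id q.2).sub_const s).inv hne).const_add E
    refine HasDerivAt.congr_deriv this ?_
    simp [neg_div]
  rw [dd_comp v (g := fun q : H × ℝ => q.2) (φ := fun t : ℝ => E + (t - s)⁻¹) h1
    differentiableAt_snd]
  congr 1
  have : fderiv ℝ (fun q : H × ℝ => q.2) q = ContinuousLinearMap.snd ℝ H ℝ :=
    (ContinuousLinearMap.snd ℝ H ℝ).fderiv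
  simp [dd, this]

lemma dd_bar (x₀ : H) (R M E s : ℝ) (v : H × ℝ) {q : H × ℝ} (hq : q ∈ reg x₀ R s) :
    dd v (bar x₀ R M E s) q = M * (phi1 (ee x₀ R q) * dd v (ee x₀ R) q * (E + (q.2 - s)⁻¹)
      + phi (ee x₀ R q) * (- ((q.2 - s) ^ 2)⁻¹ * v.2)) := by
  have hO := (reg_open x₀ R s).mem_nhds hq
  have d1 := ((phiee_contDiffOn x₀ R s).contDiffAt hO).differentiableAt (by norm_num)
  have d2 := ((theta_contDiffOn x₀ R E s (m := 2)).contDiffAt hO).differentiableAt (by norm_num)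
  have d3 := ((ee_contDiff x₀ R (m := 1)).contDiffAt (x := q)).differentiableAt (by norm_num)
  unfold bar
  rw [dd_mul v (differentiableAt_const M) (d1.fun_mul d2), dd_mul v d1 d2,
    dd_comp v (hasDerivAt_phi hq.1) d3, dd_theta x₀ R E s v hq]
  simp [dd]

lemma dd_dd_bar (x₀ : H) (R M E s : ℝ) (v : H × ℝ) (hv : v.2 = 0) {q : H × ℝ}
    (hq : q ∈ reg x₀ R s) :
    dd v (dd v (bar x₀ R M E s)) q = M * ((phi2 (ee x₀ R q) * dd v (ee x₀ R) q ^ 2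
      + phi1 (ee x₀ R q) * dd v (dd v (ee x₀ R)) q) * (E + (q.2 - s)⁻¹)) := by
  have hO := (reg_open x₀ R s).mem_nhds hq
  have hE : EqOn (dd v (bar x₀ R M E s))
    (fun q => M * (phi1 (ee x₀ R q) * dd v (ee x₀ R) q * (E + (q.2 - s)⁻¹))) (reg x₀ R s) := by
    intro z hz
    rw [dd_bar x₀ R M E s v hz, hv]; ring
  rw [dd_congr v (reg_open x₀ R s) hE hq]
  have d2 := ((theta_contDiffOn x₀ R E s (m := 2)).contDiffAt hO).differentiableAt (by norm_num)
  have d3 := ((ee_contDiff x₀ R (m := 1)).contDiffAt (x := q)).differentiableAt (by norm_num)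
  have d4 : DifferentiableAt ℝ (dd v (ee x₀ R)) q :=
    ((dd_contDiffOn (m := 1) (k := 2) v isOpen_univ (ee_contDiff x₀ R).contDiffOn
      (by norm_num)).contDiffAt univ_mem).differentiableAt (by norm_num)
  have d1 : DifferentiableAt ℝ (fun q => phi1 (ee x₀ R q)) q :=
    (hasDerivAt_phi1 hq.1).differentiableAt.comp q d3
  rw [dd_mul v (differentiableAt_const M) ((d1.fun_mul d4).fun_mul d2),
    dd_mul v (d1.fun_mul d4) d2, dd_mul v d1 d4,
    dd_comp v (hasDerivAt_phi1 hq.1) d3, dd_theta x₀ R E s v hq, hv]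
  have : dd v (fun _ : H × ℝ => M) q = 0 := by simp [dd]
  rw [this]
  ring

end barrier

section geom
variable {n : ℕ}

/-- spatial basis vector -/
def eb (i : Fin n) : EuclideanSpace ℝ (Fin n) × ℝ := (EuclideanSpace.single i 1, 0)
/-- time vector -/
def et : EuclideanSpace ℝ (Fin n) × ℝ := (0, 1)

lemma sum_single (L : EuclideanSpace ℝ (Fin n) →L[ℝ] ℝ) (y : EuclideanSpace ℝ (Fin n)) :
    ∑ i, L (EuclideanSpace.single i 1) * y i = L y := by
  have h : y = ∑ i, y i • EuclideanSpace.single i (1:ℝ) := by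
    have := (EuclideanSpace.basisFun (Fin n) ℝ).sum_repr y
    simpa using this.symm
  conv_rhs => rw [h]
  rw [map_sum]
  refine Finset.sum_congr rfl fun i _ => ?_
  rw [map_smul, smul_eq_mul, mul_comm]

lemma ray {f : EuclideanSpace ℝ (Fin n) → ℝ} {x₀ x : EuclideanSpace ℝ (Fin n)} {R K α : ℝ}
    (hn : 1 ≤ n) (hf : ContDiff ℝ 3 f) (hK : 0 ≤ K)
    (hess : ∀ x ∈ ball x₀ R, ∀ v : EuclideanSpace ℝ (Fin n),
          hessQF f x v ≥ -((n : ℝ) - 1) * K * ‖v‖ ^ 2)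
    (hα : ∀ y ∈ sphere x₀ 1, (n : ℝ) - 1 - ⟪gradient f y, y - x₀⟫ ≤ α)
    (h1 : 1 < ‖x - x₀‖) (hR : ‖x - x₀‖ < R) :
    - fderiv ℝ f x (x - x₀) ≤ R * |α| + ((n : ℝ) - 1) * K * R ^ 2 := by
  set r := ‖x - x₀‖ with hr
  set ω : EuclideanSpace ℝ (Fin n) := r⁻¹ • (x - x₀) with hω
  have hn1 : (0:ℝ) ≤ (n:ℝ) - 1 := by
    have : (1:ℝ) ≤ n := by exact_mod_cast hn
    linarith
  have r0 : 0 < r := by linarith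
  have hωn : ‖ω‖ = 1 := by
    rw [hω, norm_smul, norm_inv, norm_norm, ← hr]; field_simp
  have hxω : x - x₀ = r • ω := by rw [hω, smul_smul, mul_inv_cancel₀ r0.ne', one_smul]
  have dg : ∀ τ : ℝ, HasDerivAt (fun τ : ℝ => dd ω f (x₀ + τ • ω)) (hessQF f (x₀ + τ • ω) ω) τ := by
    intro τ
    exact dd_hasDerivAt ω (((dd_contDiffOn (m := 2) (k := 3) ω isOpen_univ hf.contDiffOn
      (by norm_num)).contDiffAt univ_mem).differentiableAt (by norm_num))
  have hmono : dd ω f (x₀ + (1:ℝ) • ω) - ((n:ℝ) - 1) * K * (r - 1) ≤ dd ω f (x₀ + r • ω) := by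
    have hm : MonotoneOn (fun τ : ℝ => dd ω f (x₀ + τ • ω) + ((n:ℝ) - 1) * K * τ) (Icc 1 r) := by
      have hd : ∀ τ : ℝ, HasDerivAt (fun τ : ℝ => dd ω f (x₀ + τ • ω) + ((n:ℝ) - 1) * K * τ)
          (hessQF f (x₀ + τ • ω) ω + ((n:ℝ) - 1) * K) τ := by
        intro τ
        simpa using (dg τ).fun_add ((hasDerivAt_id τ).const_mul (((n:ℝ) - 1) * K))
      apply monotoneOn_of_deriv_nonneg (convex_Icc _ _)
      · exact fun τ _ => (hd τ).continuousAt.continuousWithinAt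
      · exact fun τ _ => (hd τ).differentiableAt.differentiableWithinAt
      · intro τ hτ
        rw [interior_Icc] at hτ
        rw [(hd τ).deriv]
        have hb : x₀ + τ • ω ∈ ball x₀ R := by
          rw [mem_ball_iff_norm, add_sub_cancel_left, norm_smul, hωn, Real.norm_eq_abs,
            abs_of_pos (by linarith [hτ.1])]
          linarith [hτ.2]
        have := hess _ hb ω
        rw [hωn] at this
        linarith
    have := hm ⟨le_refl _, h1.le⟩ ⟨h1.le, le_refl _⟩ h1.le
    simp only at this
    linarith
  have hs : x₀ + (1:ℝ) • ω ∈ sphere x₀ 1 := by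
    rw [mem_sphere_iff_norm, add_sub_cancel_left, one_smul, hωn]
  have ha := hα _ hs
  rw [add_sub_cancel_left, one_smul] at ha
  have hgrad : ⟪gradient f (x₀ + ω), ω⟫ = dd ω f (x₀ + ω) := by
    unfold gradient dd
    rw [InnerProductSpace.toDual_symm_apply]
  rw [hgrad] at ha
  rw [one_smul] at hmono
  have hx : x₀ + r • ω = x := by rw [← hxω]; abel
  rw [hx] at hmono
  have e1 : fderiv ℝ f x (x - x₀) = r * dd ω f x := by
    rw [hxω, map_smul]; rfl
  rw [e1]
  have habs := le_abs_self α
  have habs0 := abs_nonneg α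
  have hk : 0 ≤ ((n:ℝ) - 1) * K := mul_nonneg hn1 hK
  have h3 : -dd ω f x ≤ |α| + ((n:ℝ) - 1) * K * R := by nlinarith
  have h4 : 0 ≤ |α| + ((n:ℝ) - 1) * K * R := by
    have : 0 ≤ ((n:ℝ) - 1) * K * R := mul_nonneg hk (by linarith)
    linarith
  calc -(r * dd ω f x) = r * (-dd ω f x) := by ring
    _ ≤ r * (|α| + ((n:ℝ) - 1) * K * R) := mul_le_mul_of_nonneg_left h3 r0.le
    _ ≤ R * (|α| + ((n:ℝ) - 1) * K * R) := mul_le_mul_of_nonneg_right hR.le h4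
    _ = _ := by ring

lemma ee_eq (x₀ : EuclideanSpace ℝ (Fin n)) (R : ℝ) (q : EuclideanSpace ℝ (Fin n) × ℝ) :
    ee x₀ R q = 2 / R ^ 2 * ‖q.1 - x₀‖ ^ 2 - 1 / 2 := by
  unfold ee; rw [real_inner_self_eq_norm_sq]

lemma ee_lt {x₀ : EuclideanSpace ℝ (Fin n)} {R : ℝ} (hR : 2 ≤ R)
    {q : EuclideanSpace ℝ (Fin n) × ℝ} (h : ee x₀ R q ≤ 1) : ‖q.1 - x₀‖ < R := by
  rw [ee_eq] at h
  have hR2 : 0 < R ^ 2 := by positivity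
  have : 2 / R ^ 2 * ‖q.1 - x₀‖ ^ 2 ≤ 3 / 2 := by linarith
  rw [div_mul_eq_mul_div, div_le_iff₀ hR2] at this
  apply lt_of_pow_lt_pow_left₀ 2 (by linarith)
  linarith

lemma ee_pos {x₀ : EuclideanSpace ℝ (Fin n)} {R : ℝ} (hR : 2 ≤ R)
    {q : EuclideanSpace ℝ (Fin n) × ℝ} (h : 0 < ee x₀ R q) : 1 < ‖q.1 - x₀‖ := by
  rw [ee_eq] at h
  have hR2 : 0 < R ^ 2 := by positivity
  have : 1 / 2 < 2 / R ^ 2 * ‖q.1 - x₀‖ ^ 2 := by linarith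
  rw [div_mul_eq_mul_div, lt_div_iff₀ hR2] at this
  apply lt_of_pow_lt_pow_left₀ 2 (norm_nonneg _)
  nlinarith

lemma ee_nonpos {x₀ : EuclideanSpace ℝ (Fin n)} {R : ℝ} (hR : 2 ≤ R)
    {q : EuclideanSpace ℝ (Fin n) × ℝ} (h : ‖q.1 - x₀‖ < R / 2) : ee x₀ R q ≤ 0 := by
  rw [ee_eq]
  have hR2 : 0 < R ^ 2 := by positivity
  have : 2 / R ^ 2 * ‖q.1 - x₀‖ ^ 2 ≤ 1 / 2 := by
    rw [div_mul_eq_mul_div, div_le_iff₀ hR2]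
    have := pow_le_pow_left₀ (norm_nonneg _) h.le 2
    nlinarith
  linarith

lemma dd_eb_ee (x₀ : EuclideanSpace ℝ (Fin n)) (R : ℝ) (i : Fin n)
    (q : EuclideanSpace ℝ (Fin n) × ℝ) :
    dd (eb i) (ee x₀ R) q = 4 / R ^ 2 * (q.1 - x₀) i := by
  rw [dd_ee]
  simp [eb, EuclideanSpace.inner_single_right]

lemma dd_dd_eb_ee (x₀ : EuclideanSpace ℝ (Fin n)) (R : ℝ) (i : Fin n)
    (q : EuclideanSpace ℝ (Fin n) × ℝ) :
    dd (eb i) (dd (eb i) (ee x₀ R)) q = 4 / R ^ 2 := by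
  rw [dd_dd_ee]
  simp [eb]

lemma bar_grad {x₀ : EuclideanSpace ℝ (Fin n)} {R M E s : ℝ} (hR : 2 ≤ R)
    {q : EuclideanSpace ℝ (Fin n) × ℝ} (hq : q ∈ reg x₀ R s) :
    ∑ i, dd (eb i) (bar x₀ R M E s) q ^ 2
      ≤ M ^ 2 * (E + (q.2 - s)⁻¹) ^ 2 * phi (ee x₀ R q) ^ 3 * (576 / R ^ 2) := by
  have hb := phi_bounds hq.1
  have hr := ee_lt hR hq.1.le
  have e1 : ∑ i, dd (eb i) (bar x₀ R M E s) q ^ 2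
      = M ^ 2 * (E + (q.2 - s)⁻¹) ^ 2 * phi1 (ee x₀ R q) ^ 2 * (16 / R ^ 4 * ‖q.1 - x₀‖ ^ 2) := by
    rw [EuclideanSpace.real_norm_sq_eq, Finset.mul_sum, Finset.mul_sum]
    refine Finset.sum_congr rfl fun i _ => ?_
    rw [dd_bar x₀ R M E s _ hq, dd_eb_ee]
    simp only [eb]
    ring
  rw [e1]
  have hR0 : 0 < R := by linarith
  have h2 : 16 / R ^ 4 * ‖q.1 - x₀‖ ^ 2 ≤ 16 / R ^ 2 := by
    have := pow_le_pow_left₀ (norm_nonneg _) hr.le 2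
    calc 16 / R ^ 4 * ‖q.1 - x₀‖ ^ 2 ≤ 16 / R ^ 4 * R ^ 2 := by gcongr
      _ = 16 / R ^ 2 := by field_simp
  have hphi0 : 0 ≤ phi (ee x₀ R q) := by linarith [hb.1]
  calc _ ≤ M ^ 2 * (E + (q.2 - s)⁻¹) ^ 2 * (36 * phi (ee x₀ R q) ^ 3) * (16 / R ^ 2) := by
        gcongr
        exact hb.2.2.1
    _ = _ := by ring

lemma bar_lap {f : EuclideanSpace ℝ (Fin n) → ℝ} {x₀ : EuclideanSpace ℝ (Fin n)}
    {R K α M E s : ℝ} {q : EuclideanSpace ℝ (Fin n) × ℝ}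
    (hn : 1 ≤ n) (hf : ContDiff ℝ 3 f) (hK : 0 ≤ K) (hR : 2 ≤ R) (hM : 0 ≤ M)
    (hess : ∀ x ∈ ball x₀ R, ∀ v : EuclideanSpace ℝ (Fin n),
          hessQF f x v ≥ -((n : ℝ) - 1) * K * ‖v‖ ^ 2)
    (hα : ∀ y ∈ sphere x₀ 1, (n : ℝ) - 1 - ⟪gradient f y, y - x₀⟫ ≤ α)
    (hE : 3000 * n * (1 / R ^ 2 + |α| / R + K) ≤ E)
    (hq : q ∈ reg x₀ R s) :
    ∑ i, dd (eb i) (dd (eb i) (bar x₀ R M E s)) q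
      - ∑ i, fderiv ℝ f q.1 (EuclideanSpace.single i 1) * dd (eb i) (bar x₀ R M E s) q
      - dd et (bar x₀ R M E s) q
      ≤ M * (phi (ee x₀ R q) * (E + (q.2 - s)⁻¹)) ^ 2 := by
  obtain ⟨hb1, hb2, -, hb4, hb5, hb6⟩ := phi_bounds hq.1
  have hr := ee_lt hR hq.1.le
  have hR0 : 0 < R := by linarith
  have hn1 : (1:ℝ) ≤ n := by exact_mod_cast hn
  have hts : 0 < (q.2 - s)⁻¹ := by
    have := hq.2
    rw [inv_pos]; linarith
  have e1 : ∑ i, dd (eb i) (dd (eb i) (bar x₀ R M E s)) q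
      = M * ((phi2 (ee x₀ R q) * (16 / R ^ 4 * ‖q.1 - x₀‖ ^ 2)
        + phi1 (ee x₀ R q) * (4 * n / R ^ 2)) * (E + (q.2 - s)⁻¹)) := by
    have : ∀ i, dd (eb i) (dd (eb i) (bar x₀ R M E s)) q
      = (M * (E + (q.2 - s)⁻¹) * phi2 (ee x₀ R q) * (16 / R ^ 4)) * (q.1 - x₀) i ^ 2
        + M * (phi1 (ee x₀ R q) * (4 / R ^ 2)) * (E + (q.2 - s)⁻¹) := by
      intro i
      rw [dd_dd_bar x₀ R M E s _ rfl hq, dd_eb_ee, dd_dd_eb_ee]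
      ring
    simp only [this]
    rw [Finset.sum_add_distrib, ← Finset.mul_sum, ← EuclideanSpace.real_norm_sq_eq,
      Finset.sum_const, Finset.card_univ, Fintype.card_fin, nsmul_eq_mul]
    ring
  have e2 : ∑ i, fderiv ℝ f q.1 (EuclideanSpace.single i 1) * dd (eb i) (bar x₀ R M E s) q
      = M * (phi1 (ee x₀ R q) * (4 / R ^ 2 * fderiv ℝ f q.1 (q.1 - x₀)) * (E + (q.2 - s)⁻¹)) := by
    rw [← sum_single]
    simp only [Finset.mul_sum, Finset.sum_mul]
    refine Finset.sum_congr rfl fun i _ => ?_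
    rw [dd_bar x₀ R M E s _ hq, dd_eb_ee]
    simp only [eb]
    ring
  have e3 : dd et (bar x₀ R M E s) q = - (M * (phi (ee x₀ R q) * (q.2 - s)⁻¹ ^ 2)) := by
    rw [dd_bar x₀ R M E s _ hq, dd_ee]
    simp [et]
  rw [e1, e2, e3]
  set φ := phi (ee x₀ R q)
  set φ1 := phi1 (ee x₀ R q)
  set φ2 := phi2 (ee x₀ R q)
  set L := fderiv ℝ f q.1 (q.1 - x₀)
  set y := (q.2 - s)⁻¹
  have hE0 : 0 ≤ E := le_trans (by positivity) hE
  have b1 : φ2 * (16 / R ^ 4 * ‖q.1 - x₀‖ ^ 2) ≤ φ ^ 2 * (1056 / R ^ 2) := by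
    have h2 : 16 / R ^ 4 * ‖q.1 - x₀‖ ^ 2 ≤ 16 / R ^ 2 := by
      have := pow_le_pow_left₀ (norm_nonneg _) hr.le 2
      calc 16 / R ^ 4 * ‖q.1 - x₀‖ ^ 2 ≤ 16 / R ^ 4 * R ^ 2 := by gcongr
        _ = 16 / R ^ 2 := by field_simp
    calc _ ≤ (66 * φ ^ 2) * (16 / R ^ 4 * ‖q.1 - x₀‖ ^ 2) := by gcongr
      _ ≤ (66 * φ ^ 2) * (16 / R ^ 2) := by gcongr
      _ = _ := by ring
  have b2 : φ1 * (4 * n / R ^ 2) - φ1 * (4 / R ^ 2 * L)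
      ≤ φ ^ 2 * (24 * n / R ^ 2 + 24 * (|α| / R) + 24 * n * K) := by
    rcases le_or_gt (ee x₀ R q) 0 with h0 | h0
    · rw [show φ1 = 0 from hb6 h0]
      simp only [zero_mul, sub_zero]
      positivity
    · have hL := ray hn hf hK hess hα (ee_pos hR h0) hr
      have hL' : 4 / R ^ 2 * (n - L) ≤ 4 / R ^ 2 * (n + R * |α| + n * K * R ^ 2) := by
        apply mul_le_mul_of_nonneg_left _ (by positivity)
        have : 0 ≤ K * R ^ 2 := by positivity
        change -L ≤ _ at hL
        nlinarith
      have hL2 : 4 / R ^ 2 * (n + R * |α| + n * K * R ^ 2)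
          = 4 * n / R ^ 2 + 4 * (|α| / R) + 4 * n * K := by field_simp
      have hL3 : 0 ≤ 4 * n / R ^ 2 + 4 * (|α| / R) + 4 * n * K := by positivity
      calc φ1 * (4 * n / R ^ 2) - φ1 * (4 / R ^ 2 * L) = φ1 * (4 / R ^ 2 * (n - L)) := by ring
        _ ≤ φ1 * (4 * n / R ^ 2 + 4 * (|α| / R) + 4 * n * K) := by
            rw [← hL2]; exact mul_le_mul_of_nonneg_left hL' hb2
        _ ≤ (6 * φ ^ 2) * (4 * n / R ^ 2 + 4 * (|α| / R) + 4 * n * K) :=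
            mul_le_mul_of_nonneg_right hb4 hL3
        _ = _ := by ring
  have b3 : 1056 / R ^ 2 + (24 * n / R ^ 2 + 24 * (|α| / R) + 24 * n * K) ≤ E := by
    refine le_trans ?_ hE
    have i1 : 0 ≤ 1 / R ^ 2 := by positivity
    have i2 : 0 ≤ |α| / R := by positivity
    have j1 : 1 / R ^ 2 ≤ n * (1 / R ^ 2) := le_mul_of_one_le_left i1 hn1
    have j2 : |α| / R ≤ n * (|α| / R) := le_mul_of_one_le_left i2 hn1
    have j3 : 0 ≤ n * K := by positivity
    have k1 : 1056 / R ^ 2 = 1056 * (1 / R ^ 2) := by ring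
    have k2 : 24 * n / R ^ 2 = 24 * (n * (1 / R ^ 2)) := by ring
    rw [k1, k2]
    nlinarith
  have b4 : φ2 * (16 / R ^ 4 * ‖q.1 - x₀‖ ^ 2) + φ1 * (4 * n / R ^ 2) - φ1 * (4 / R ^ 2 * L)
      ≤ φ ^ 2 * E := by
    calc _ ≤ φ ^ 2 * (1056 / R ^ 2 + (24 * n / R ^ 2 + 24 * (|α| / R) + 24 * n * K)) := by
          linarith
      _ ≤ _ := by gcongr
  have b5 : (φ2 * (16 / R ^ 4 * ‖q.1 - x₀‖ ^ 2) + φ1 * (4 * n / R ^ 2) - φ1 * (4 / R ^ 2 * L))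
      * (E + y) ≤ φ ^ 2 * E * (E + y) := mul_le_mul_of_nonneg_right b4 (by positivity)
  have b6 : φ * y ^ 2 ≤ φ ^ 2 * y ^ 2 := by
    gcongr
    nlinarith
  have b7 : 0 ≤ φ ^ 2 * E * y := by positivity
  calc _ = M * ((φ2 * (16 / R ^ 4 * ‖q.1 - x₀‖ ^ 2) + φ1 * (4 * n / R ^ 2)
        - φ1 * (4 / R ^ 2 * L)) * (E + y) + φ * y ^ 2) := by ring
    _ ≤ M * (φ * (E + y)) ^ 2 := by
      apply mul_le_mul_of_nonneg_left _ hM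
      nlinarith

end geom

lemma final_contra {F M D P U S G c c₂ Lp : ℝ} (hD : 0 < D) (hM : 9 * D < M) (hP : 0 < P)
    (hF : F = M * P) (hU : 0 < U) (hUD : U ≤ D) (hc : c ≤ c₂) (hc0 : 0 ≤ c₂) (hcP : c₂ ≤ P)
    (hS : S ^ 2 ≤ (U * F) * G) (hG : G ≤ M ^ 2 * P ^ 3 / 4) (hL : Lp ≤ M * P ^ 2)
    (main : F ^ 2 / 2 ≤ c * (U * F) + S + U * Lp) : False := by
  have hM0 : 0 < M := by linarith
  subst hF
  have a1 : c * (U * (M * P)) ≤ D * (M * P ^ 2) := by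
    calc c * (U * (M * P)) ≤ c₂ * (U * (M * P)) := by gcongr
      _ ≤ P * (D * (M * P)) := by gcongr
      _ = _ := by ring
  have a2 : U * Lp ≤ D * (M * P ^ 2) := by
    calc U * Lp ≤ U * (M * P ^ 2) := by gcongr
      _ ≤ _ := by gcongr
  have hD9 : D ≤ M / 9 := by linarith
  have a3 : S ≤ M ^ 2 * P ^ 2 / 6 := by
    apply le_of_sq_le_sq _ (by positivity)
    calc S ^ 2 ≤ (U * (M * P)) * G := hS
      _ ≤ (U * (M * P)) * (M ^ 2 * P ^ 3 / 4) := by gcongr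
      _ ≤ ((M / 9) * (M * P)) * (M ^ 2 * P ^ 3 / 4) := by gcongr; linarith
      _ = (M ^ 2 * P ^ 2 / 6) ^ 2 := by ring
  have a4 : D * (M * P ^ 2) ≤ M / 9 * (M * P ^ 2) := by gcongr
  have a5 : 0 < M ^ 2 * P ^ 2 := by positivity
  nlinarith

section main
variable {n : ℕ}

lemma dd_fst {g : EuclideanSpace ℝ (Fin n) → ℝ} (v : EuclideanSpace ℝ (Fin n)) (b : ℝ)
    (q : EuclideanSpace ℝ (Fin n) × ℝ) (hg : DifferentiableAt ℝ g q.1) :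
    dd (v, b) (fun q : EuclideanSpace ℝ (Fin n) × ℝ => g q.1) q = dd v g q.1 := by
  have h := hg.hasFDerivAt.comp q (hasFDerivAt_fst (𝕜 := ℝ) (p := q))
  have h2 : fderiv ℝ (fun q : EuclideanSpace ℝ (Fin n) × ℝ => g q.1) q = _ := h.fderiv
  unfold dd
  rw [h2]; simp

lemma hess_expand {f : EuclideanSpace ℝ (Fin n) → ℝ} (hf : ContDiff ℝ 3 f)
    (q : EuclideanSpace ℝ (Fin n) × ℝ) (v : EuclideanSpace ℝ (Fin n)) :
    hessQF f q.1 v = ∑ i, ∑ j, dd (eb j) (dd (eb i) (fun q => f q.1)) q * v i * v j := by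
  have hd1 : ∀ x, DifferentiableAt ℝ f x := fun x => (hf.differentiable (by norm_num)) x
  have hd2 : ∀ w x, DifferentiableAt ℝ (dd w f) x := fun w x =>
    ((dd_contDiffOn (m := 2) (k := 3) w isOpen_univ hf.contDiffOn
      (by norm_num)).contDiffAt univ_mem).differentiableAt (by norm_num)
  have e1 : ∀ i j, dd (eb j) (dd (eb i) (fun q : EuclideanSpace ℝ (Fin n) × ℝ => f q.1)) q
      = dd (EuclideanSpace.single j 1) (dd (EuclideanSpace.single i 1) f) q.1 := by
    intro i j
    have : dd (eb i) (fun q : EuclideanSpace ℝ (Fin n) × ℝ => f q.1)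
        = fun q => dd (EuclideanSpace.single i 1) f q.1 := by
      ext z; exact dd_fst _ _ z (hd1 _)
    rw [this]
    exact dd_fst _ _ q (hd2 _ _)
  simp only [e1]
  change dd v (dd v f) q.1 = _
  have e2 : dd v f = fun y => ∑ i, dd (EuclideanSpace.single i 1) f y * v i := by
    ext y; exact (sum_single (fderiv ℝ f y) v).symm
  conv_lhs => rw [e2]
  rw [dd_sum _ _ (fun i _ => (hd2 _ _).mul_const _)]
  refine Finset.sum_congr rfl fun i _ => ?_
  rw [dd_mul v (hd2 _ _) (differentiableAt_const _)]
  have : dd v (fun _ => v i) q.1 = 0 := by simp [dd]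
  rw [this, mul_zero, add_zero]
  have := sum_single (fderiv ℝ (dd (EuclideanSpace.single i 1) f) q.1) v
  change _ = dd v (dd (EuclideanSpace.single i 1) f) q.1 at this
  rw [← this, Finset.sum_mul]
  refine Finset.sum_congr rfl fun j _ => ?_
  simp only [dd]; ring

lemma interior_est {f : EuclideanSpace ℝ (Fin n) → ℝ} {x₀ : EuclideanSpace ℝ (Fin n)}
    {R K α E s t₁ τ₀ τ₁ a δ D : ℝ} {U : EuclideanSpace ℝ (Fin n) × ℝ → ℝ}
    (hn : 1 ≤ n) (hf : ContDiff ℝ 3 f) (hK : 0 ≤ K) (hR : 2 ≤ R) (ha : a < 0) (hδ : 0 < δ)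
    (hess : ∀ x ∈ ball x₀ R, ∀ v : EuclideanSpace ℝ (Fin n),
          hessQF f x v ≥ -((n : ℝ) - 1) * K * ‖v‖ ^ 2)
    (hα : ∀ y ∈ sphere x₀ 1, (n : ℝ) - 1 - ⟪gradient f y, y - x₀⟫ ≤ α)
    (hE : 3000 * n * (1 / R ^ 2 + |α| / R + K)
      + max (2 * ((n : ℝ) - 1) * K + a * (2 + Real.log δ)) 0 ≤ E)
    (hU : ContDiffOn ℝ 3 U (ball x₀ R ×ˢ Ioo τ₀ τ₁))
    (hUb : ∀ q ∈ ball x₀ R ×ˢ Ioo τ₀ τ₁, δ ≤ U q ∧ U q ≤ D)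
    (pde : ∀ q ∈ ball x₀ R ×ˢ Ioo τ₀ τ₁, dd et U q = ∑ i, dd (eb i) (dd (eb i) U) q
      - ∑ i, dd (eb i) (fun q => f q.1) q * dd (eb i) U q + a * (U q * Real.log (U q)))
    (hs : τ₀ < s) (hst : s < t₁) (ht : t₁ < τ₁)
    {x : EuclideanSpace ℝ (Fin n)} (hx : x ∈ ball x₀ (R / 2)) :
    ∑ j, dd (eb j) U (x, t₁) ^ 2 ≤ 9 * D * (E + (t₁ - s)⁻¹) * U (x, t₁) := by
  set O : Set (EuclideanSpace ℝ (Fin n) × ℝ) := ball x₀ R ×ˢ Ioo τ₀ τ₁ with hOdef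
  have hO : IsOpen O := isOpen_ball.prod isOpen_Ioo
  have hn1 : (1:ℝ) ≤ n := by exact_mod_cast hn
  have hR0 : 0 < R := by linarith
  set c₂ := max (2 * ((n : ℝ) - 1) * K + a * (2 + Real.log δ)) 0 with hc₂
  have hc0 : 0 ≤ c₂ := le_max_right _ _
  have hE1 : 3000 * n * (1 / R ^ 2 + |α| / R + K) ≤ E := by linarith
  have hEA : 3000 * (1 / R ^ 2) ≤ E := by
    refine le_trans ?_ hE1
    have i1 : 0 < 1 / R ^ 2 := by positivity
    have i2 : 0 ≤ |α| / R := by positivity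
    calc 3000 * (1 / R ^ 2) ≤ 3000 * n * (1 / R ^ 2) := by nlinarith
      _ ≤ _ := by gcongr; linarith
  have hE0 : 0 < E := lt_of_lt_of_le (by positivity) hEA
  have hEc : c₂ ≤ E := by
    have : 0 ≤ 3000 * n * (1 / R ^ 2 + |α| / R + K) := by positivity
    linarith
  by_contra! hcon
  have hU0 : ∀ q ∈ O, 0 < U q := fun q hq => lt_of_lt_of_le hδ (hUb q hq).1
  set Kc : Set (EuclideanSpace ℝ (Fin n) × ℝ) :=
    {q | ee x₀ R q ≤ 1} ∩ (closedBall x₀ R ×ˢ Icc s t₁) with hKc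
  have hKcomp : IsCompact Kc := by
    apply IsCompact.inter_left
    · exact (isCompact_closedBall x₀ R).prod isCompact_Icc
    · exact isClosed_le (ee_contDiff (m := 0) x₀ R).continuous continuous_const
  have hKO : Kc ⊆ O := by
    rintro q ⟨h1, h2⟩
    refine ⟨?_, ?_, ?_⟩
    · rw [mem_ball_iff_norm]; exact ee_lt hR h1
    · linarith [h2.2.1]
    · linarith [h2.2.2]
  have hKmem : ∀ q ∈ reg x₀ R s, q.2 ≤ t₁ → q ∈ Kc := by
    intro q hq hqt
    refine ⟨hq.1.le, ?_, hq.2.le, hqt⟩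
    rw [mem_closedBall_iff_norm]; exact (ee_lt hR hq.1.le).le
  set Q : EuclideanSpace ℝ (Fin n) × ℝ → ℝ := fun q => ∑ j, dd (eb j) U q ^ 2 with hQ
  have hQ0 : ∀ q, 0 ≤ Q q := fun q => Finset.sum_nonneg fun j _ => sq_nonneg _
  have hQc : ContinuousOn Q O := by
    apply continuousOn_finsetSum
    intro j _
    exact (dd_contDiffOn (m := 2) (eb j) hO hU (by norm_num)).continuousOn.pow 2
  set W : EuclideanSpace ℝ (Fin n) × ℝ → ℝ := fun q =>
    Q q * (1 - cub (ee x₀ R q)) ^ 2 * ((q.2 - s) / (1 + E * (q.2 - s))) / U q with hW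
  have hWc : ContinuousOn W Kc := by
    apply ContinuousOn.div
    · apply ContinuousOn.mul
      · apply (hQc.mono hKO).mul
        exact ((continuous_const.sub (contDiff_cub.continuous.comp
          (ee_contDiff (m := 0) x₀ R).continuous)).pow 2).continuousOn
      · apply ContinuousOn.div
        · fun_prop
        · fun_prop
        · intro q hq
          have : 0 ≤ E * (q.2 - s) := mul_nonneg hE0.le (by linarith [hq.2.2.1])
          linarith
    · exact hU.continuousOn.mono hKO
    · exact fun q hq => (hU0 q (hKO hq)).ne'
  have hWeq : ∀ q ∈ reg x₀ R s, q ∈ O →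
      W q * (U q * (phi (ee x₀ R q) * (E + (q.2 - s)⁻¹))) = Q q := by
    intro q hq hqO
    have h1 : 1 - cub (ee x₀ R q) ≠ 0 := by have := cub_lt_one hq.1; linarith
    have h2 : 0 < q.2 - s := by have := hq.2; linarith
    have h3 : 0 < 1 + E * (q.2 - s) := by positivity
    have h4 := (hU0 q hqO).ne'
    simp only [hW, phi]
    field_simp
    ring
  have hxreg : (x, t₁) ∈ reg x₀ R s := by
    refine ⟨?_, hst⟩
    have := ee_nonpos (q := (x, t₁)) hR (mem_ball_iff_norm.1 hx)
    linarith
  have hxK := hKmem _ hxreg le_rfl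
  obtain ⟨p, hpK, hpmax⟩ := hKcomp.exists_isMaxOn ⟨_, hxK⟩ hWc
  set M := W p with hM
  have hM9 : 9 * D < M := by
    refine lt_of_lt_of_le ?_ (hpmax hxK)
    have h1 := hWeq _ hxreg (hKO hxK)
    have h2 : phi (ee x₀ R (x, t₁)) = 1 := by
      have := ee_nonpos (q := (x, t₁)) hR (mem_ball_iff_norm.1 hx)
      simp [phi, cub, max_eq_right this]
    rw [h2, one_mul] at h1
    have h3 := hU0 _ (hKO hxK)
    have h4 : 0 < (t₁ - s)⁻¹ := by rw [inv_pos]; linarith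
    change 9 * D * (E + (t₁ - s)⁻¹) * U (x, t₁) < Q (x, t₁) at hcon
    rw [← h1] at hcon
    simp only at hcon
    have h5 : 0 < U (x, t₁) * (E + (t₁ - s)⁻¹) := by positivity
    by_contra! h6
    have := mul_le_mul_of_nonneg_right h6 h5.le
    linarith
  have hpO := hKO hpK
  have hD : 0 < D := lt_of_lt_of_le (hU0 p hpO) (hUb p hpO).2
  have hM0 : 0 < M := by linarith
  have hpreg : p ∈ reg x₀ R s := by
    have hMne : W p ≠ 0 := hM0.ne'
    refine ⟨lt_of_le_of_ne hpK.1 ?_, lt_of_le_of_ne hpK.2.2.1 ?_⟩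
    · intro h
      apply hMne
      simp [hW, h, cub]
    · intro h
      apply hMne
      simp [hW, ← h]
  have hN : IsOpen (O ∩ reg x₀ R s) := hO.inter (reg_open _ _ _)
  have hle : ∀ q ∈ O ∩ reg x₀ R s, q.2 ≤ t₁ → Q q ≤ U q * bar x₀ R M E s q := by
    intro q hq hqt
    have h1 : W q ≤ M := hpmax (hKmem q hq.2 hqt)
    rw [← hWeq q hq.2 hq.1]
    have h2 : 0 < (q.2 - s)⁻¹ := by rw [inv_pos]; linarith [hq.2.2]
    have h3 := (phi_bounds hq.2.1).1
    have h4 := hU0 q hq.1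
    calc _ ≤ M * (U q * (phi (ee x₀ R q) * (E + (q.2 - s)⁻¹))) := by gcongr
      _ = _ := by unfold bar; ring
  have hQp : Q p = U p * bar x₀ R M E s p := by
    rw [← hWeq p hpreg hpO]; unfold bar; ring
  have hf3 : ContDiff ℝ 3 (fun q : EuclideanSpace ℝ (Fin n) × ℝ => f q.1) :=
    hf.comp contDiff_fst
  have main := core (a := a) (k := ((n:ℝ) - 1) * K) hN ⟨hpO, hpreg⟩ eb et
    (hU.mono inter_subset_left) hf3.contDiffOn
    ((bar_contDiffOn x₀ R M E s).mono inter_subset_right) (fun q hq => hU0 q hq.1)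
    (fun q hq => pde q hq.1) hQp
    (fun i τ h => hle _ h (by simpa [eb] using hpK.2.2.2))
    (fun τ h0 h => hle _ h (by
      have := hpK.2.2.2
      simp only [et, Prod.snd_add, Prod.smul_snd, smul_eq_mul, mul_one]; linarith))
    (by
      have h1 := hess p.1 hpO.1 (WithLp.toLp 2 fun i => dd (eb i) U p)
      rw [hess_expand hf p, EuclideanSpace.real_norm_sq_eq] at h1
      simp only [PiLp.toLp_apply] at h1
      linarith)
  have hb1 := (phi_bounds hpreg.1).1
  have hts : 0 < (p.2 - s)⁻¹ := by rw [inv_pos]; linarith [hpreg.2]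
  have hθP : E ≤ phi (ee x₀ R p) * (E + (p.2 - s)⁻¹) := by nlinarith
  have hlap := bar_lap (M := M) hn hf hK hR hM0.le hess hα hE1 hpreg
  have hfi : ∀ i, dd (eb i) (fun q : EuclideanSpace ℝ (Fin n) × ℝ => f q.1) p
      = fderiv ℝ f p.1 (EuclideanSpace.single i 1) := fun i =>
    dd_fst _ _ p ((hf.differentiable (by norm_num)) _)
  simp only [hfi] at main
  refine final_contra (c₂ := c₂) hD hM9 (lt_of_lt_of_le hE0 hθP) rfl (hU0 p hpO) (hUb p hpO).2 ?_ hc0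
    (hEc.trans hθP) (G := ∑ i, dd (eb i) (bar x₀ R M E s) p ^ 2) ?_ ?_ hlap main
  · have hlog : Real.log δ ≤ Real.log (U p) := Real.log_le_log hδ (hUb p hpO).1
    refine le_trans ?_ (le_max_left _ _)
    nlinarith
  · have h := Finset.sum_mul_sq_le_sq_mul_sq Finset.univ (fun i => dd (eb i) U p)
      (fun i => dd (eb i) (bar x₀ R M E s) p)
    have e : ∑ i, dd (eb i) U p ^ 2 = U p * bar x₀ R M E s p := hQp
    rw [e] at h
    exact h
  · refine (bar_grad hR hpreg).trans ?_
    have h1 : 576 / R ^ 2 ≤ (E + (p.2 - s)⁻¹) / 4 := by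
      have : 576 / R ^ 2 = 576 * (1 / R ^ 2) := by ring
      have i1 : 0 < 1 / R ^ 2 := by positivity
      rw [this]; linarith
    calc _ ≤ M ^ 2 * (E + (p.2 - s)⁻¹) ^ 2 * phi (ee x₀ R p) ^ 3 * ((E + (p.2 - s)⁻¹) / 4) := by
          gcongr
      _ = _ := by ring

end main

section slices
variable {n : ℕ}

lemma slice_x {g : EuclideanSpace ℝ (Fin n) × ℝ → ℝ} {x : EuclideanSpace ℝ (Fin n)} {t : ℝ}
    (hg : DifferentiableAt ℝ g (x, t)) (v : EuclideanSpace ℝ (Fin n)) :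
    fderiv ℝ (fun y => g (y, t)) x v = dd (v, 0) g (x, t) := by
  have h := hg.hasFDerivAt.comp x (hasFDerivAt_prodMk_left (𝕜 := ℝ) x t)
  have h2 : fderiv ℝ (fun y => g (y, t)) x = _ := h.fderiv
  rw [h2]; simp [dd]

lemma slice_t {g : EuclideanSpace ℝ (Fin n) × ℝ → ℝ} {x : EuclideanSpace ℝ (Fin n)} {t : ℝ}
    (hg : DifferentiableAt ℝ g (x, t)) :
    deriv (fun s => g (x, s)) t = dd et g (x, t) := by
  have h := (hg.hasFDerivAt.comp t (hasFDerivAt_prodMk_right (𝕜 := ℝ) x t)).hasDerivAt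
  have h2 : deriv (fun s => g (x, s)) t = _ := h.deriv
  rw [h2]; simp [dd, et]

lemma grad_norm_sq (g : EuclideanSpace ℝ (Fin n) → ℝ) (x : EuclideanSpace ℝ (Fin n)) :
    ‖gradient g x‖ ^ 2 = ∑ i, fderiv ℝ g x (EuclideanSpace.single i 1) ^ 2 := by
  rw [EuclideanSpace.real_norm_sq_eq]
  refine Finset.sum_congr rfl fun i _ => ?_
  congr 1
  have : ⟪gradient g x, EuclideanSpace.single i (1:ℝ)⟫
      = fderiv ℝ g x (EuclideanSpace.single i 1) := by
    unfold gradient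
    rw [InnerProductSpace.toDual_symm_apply]
  rw [← this, EuclideanSpace.inner_single_right]
  simp

lemma grad_inner (f g : EuclideanSpace ℝ (Fin n) → ℝ) (x : EuclideanSpace ℝ (Fin n)) :
    ⟪gradient f x, gradient g x⟫ = ∑ i, fderiv ℝ f x (EuclideanSpace.single i 1)
      * fderiv ℝ g x (EuclideanSpace.single i 1) := by
  have h : ∀ i, (gradient g x) i = fderiv ℝ g x (EuclideanSpace.single i 1) := by
    intro i
    have : ⟪gradient g x, EuclideanSpace.single i (1:ℝ)⟫
        = fderiv ℝ g x (EuclideanSpace.single i 1) := by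
      unfold gradient
      rw [InnerProductSpace.toDual_symm_apply]
    rw [← this, EuclideanSpace.inner_single_right]
    simp
  have h2 : ⟪gradient f x, gradient g x⟫ = fderiv ℝ f x (gradient g x) := by
    conv_lhs => unfold gradient
    rw [InnerProductSpace.toDual_symm_apply]
    rfl
  rw [h2, ← sum_single]
  simp only [h]

lemma alpha_le {f : EuclideanSpace ℝ (Fin n) → ℝ} (hf : ContDiff ℝ 3 f)
    (x₀ : EuclideanSpace ℝ (Fin n)) :
    ∀ y ∈ sphere x₀ 1, (n : ℝ) - 1 - ⟪gradient f y, y - x₀⟫ ≤ alphaC f x₀ := by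
  intro y hy
  unfold alphaC
  apply le_csSup
  · apply (isCompact_sphere x₀ 1).bddAbove_image
    have : Continuous (gradient f) := by
      unfold gradient
      exact (LinearIsometryEquiv.continuous _).comp (hf.continuous_fderiv (by norm_num))
    apply Continuous.continuousOn
    exact continuous_const.sub (this.inner (by fun_prop))
  · exact ⟨y, hy, rfl⟩

lemma grad_cont {u : EuclideanSpace ℝ (Fin n) → ℝ → ℝ} {x₀ x : EuclideanSpace ℝ (Fin n)}
    {R b c : ℝ} (hbc : b < c)
    (hu : ContDiffOn ℝ 3 (fun p : EuclideanSpace ℝ (Fin n) × ℝ => u p.1 p.2)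
          (ball x₀ R ×ˢ Icc b c)) (hx : x ∈ ball x₀ R) :
    ContinuousOn (fun t => ‖gradient (fun y => u y t) x‖) (Icc b c) := by
  set S := ball x₀ R ×ˢ Icc b c
  set U : EuclideanSpace ℝ (Fin n) × ℝ → ℝ := fun p => u p.1 p.2
  have hS : UniqueDiffOn ℝ S := isOpen_ball.uniqueDiffOn.prod (uniqueDiffOn_Icc hbc)
  have h1 : ContinuousOn (fun q => fderivWithin ℝ U S q) S :=
    hu.continuousOn_fderivWithin hS (by norm_num)
  have h2 : ContinuousOn (fun t : ℝ => (fderivWithin ℝ U S (x, t)).comp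
      (ContinuousLinearMap.inl ℝ (EuclideanSpace ℝ (Fin n)) ℝ)) (Icc b c) := by
    apply ContinuousOn.clm_comp
    · exact h1.comp (by fun_prop) (fun t ht => ⟨hx, ht⟩)
    · exact continuousOn_const
  refine h2.norm.congr ?_
  intro t ht
  have hd := (hu.differentiableOn (by norm_num) (x, t) ⟨hx, ht⟩).hasFDerivWithinAt
  have h3 := HasFDerivWithinAt.comp (g := U) (f := fun y => (y, t)) (s := ball x₀ R) (t := S) x hd
    (hasFDerivAt_prodMk_left (𝕜 := ℝ) x t).hasFDerivWithinAt (fun y hy => ⟨hy, ht⟩)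
  have h4 : fderiv ℝ (fun y => u y t) x = _ :=
    (h3.hasFDerivAt (isOpen_ball.mem_nhds hx)).fderiv
  unfold gradient
  simp only [LinearIsometryEquiv.norm_map]
  rw [h4]

lemma three_le : (3 : WithTop ℕ∞) ≤ ((⊤ : ℕ∞) : WithTop ℕ∞) :=
  WithTop.coe_le_coe.2 (le_top : (3 : ℕ∞) ≤ ⊤)

end slices

end Ham

open Ham

/-- Hamilton-type gradient estimate for the nonlinear `f`-heat equation, case `a < 0`
(Euclidean case of Theorem 1.1(ii)). -/
theorem hamilton_gradient_estimate_neg (n : ℕ) (hn : 1 ≤ n) :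
    ∃ c : ℝ, 0 < c ∧
      ∀ (f : EuclideanSpace ℝ (Fin n) → ℝ) (x₀ : EuclideanSpace ℝ (Fin n))
        (R K t₀ T a δ D : ℝ) (u : EuclideanSpace ℝ (Fin n) → ℝ → ℝ),
        ContDiff ℝ (⊤ : ℕ∞) f →
        2 ≤ R → 0 ≤ K → 0 < T → a < 0 → 0 < δ → δ ≤ D →
        (∀ x ∈ ball x₀ R, ∀ v : EuclideanSpace ℝ (Fin n),
          hessQF f x v ≥ -((n : ℝ) - 1) * K * ‖v‖ ^ 2) →
        ContDiffOn ℝ (⊤ : ℕ∞) (fun p : EuclideanSpace ℝ (Fin n) × ℝ => u p.1 p.2)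
          (ball x₀ R ×ˢ Icc (t₀ - T) t₀) →
        (∀ x ∈ ball x₀ R, ∀ t ∈ Icc (t₀ - T) t₀, δ ≤ u x t ∧ u x t ≤ D) →
        (∀ x ∈ ball x₀ R, ∀ t ∈ Icc (t₀ - T) t₀,
          deriv (fun s => u x s) t
            = fLap f (fun y => u y t) x + a * u x t * Real.log (u x t)) →
        ∀ x ∈ ball x₀ (R / 2), ∀ t ∈ Ioc (t₀ - T) t₀,
          ‖gradient (fun y => u y t) x‖ / Real.sqrt (u x t) ≤
            c * Real.sqrt D *
              (1 / R + Real.sqrt (|alphaC f x₀| / R) + 1 / Real.sqrt (t - t₀ + T)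
                + Real.sqrt K
                + Real.sqrt (max (2 * ((n : ℝ) - 1) * K + a * (2 + Real.log δ)) 0)) := by
  have hn1 : (1:ℝ) ≤ n := by exact_mod_cast hn
  have hn0 : (0:ℝ) < n := by linarith
  refine ⟨3 * Real.sqrt (3000 * n), by positivity, ?_⟩
  intro f x₀ R K t₀ T a δ D u hf hR hK hT ha hδ hδD hess hu hub hpde x hx t ht
  have hf3 : ContDiff ℝ 3 f := hf.of_le three_le
  have hu3 := hu.of_le three_le
  have hD : 0 < D := lt_of_lt_of_le hδ hδD
  have hR0 : 0 < R := by linarith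
  have hxR : x ∈ ball x₀ R := ball_subset_ball (by linarith) hx
  have hα := alpha_le hf3 x₀
  generalize hc₂ : max (2 * ((n : ℝ) - 1) * K + a * (2 + Real.log δ)) 0 = c₂
  have hc0 : 0 ≤ c₂ := by rw [← hc₂]; exact le_max_right _ _
  generalize alphaC f x₀ = α at hα ⊢
  set E := 3000 * n * (1 / R ^ 2 + |α| / R + K) + c₂ with hE
  set U : EuclideanSpace ℝ (Fin n) × ℝ → ℝ := fun p => u p.1 p.2 with hU
  have hsub : ball x₀ R ×ˢ Ioo (t₀ - T) t₀ ⊆ ball x₀ R ×ˢ Icc (t₀ - T) t₀ :=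
    prod_mono le_rfl Ioo_subset_Icc_self
  have hO : IsOpen (ball x₀ R ×ˢ Ioo (t₀ - T) t₀) := isOpen_ball.prod isOpen_Ioo
  have hU3 : ContDiffOn ℝ 3 U (ball x₀ R ×ˢ Ioo (t₀ - T) t₀) := hu3.mono hsub
  have hUd : ∀ q ∈ ball x₀ R ×ˢ Ioo (t₀ - T) t₀, DifferentiableAt ℝ U q := fun q hq =>
    (hU3.contDiffAt (hO.mem_nhds hq)).differentiableAt (by norm_num)
  have hUdi : ∀ v, ∀ q ∈ ball x₀ R ×ˢ Ioo (t₀ - T) t₀, DifferentiableAt ℝ (dd v U) q :=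
    fun v q hq => ((dd_contDiffOn (m := 2) v hO hU3 (by norm_num)).contDiffAt
      (hO.mem_nhds hq)).differentiableAt (by norm_num)
  -- interior times
  have hinterior : ∀ t' ∈ Ioo (t₀ - T) t₀, ‖gradient (fun y => u y t') x‖ ^ 2
      ≤ 9 * D * (E + (t' - (t₀ - T))⁻¹) * u x t' := by
    intro t' ht'
    have hs : ∀ s ∈ Ioo (t₀ - T) t', ‖gradient (fun y => u y t') x‖ ^ 2
        ≤ 9 * D * (E + (t' - s)⁻¹) * u x t' := by
      intro s hs
      have h := interior_est (f := f) (x₀ := x₀) (R := R) (K := K) (α := α) (E := E) (s := s)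
        (t₁ := t') (τ₀ := t₀ - T) (τ₁ := t₀) (a := a) (δ := δ) (D := D) (U := U)
        hn hf3 hK hR ha hδ hess hα (by rw [hc₂]) hU3
        (fun q hq => hub q.1 hq.1 q.2 (Ioo_subset_Icc_self hq.2)) ?_ hs.1 hs.2 ht'.2 hx
      · rw [grad_norm_sq]
        have e : ∀ i, fderiv ℝ (fun y => u y t') x (EuclideanSpace.single i 1)
            = dd (eb i) U (x, t') := fun i => slice_x (hUd (x, t') ⟨hxR, ht'⟩) _
        simp only [e]
        exact h
      · rintro ⟨y, r⟩ hq
        have h1 := hpde y hq.1 r (Ioo_subset_Icc_self hq.2)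
        have e1 : deriv (fun s => u y s) r = dd et U (y, r) := slice_t (hUd _ hq)
        rw [e1] at h1
        rw [h1]
        unfold fLap eLap
        rw [grad_inner]
        have e2 : ∀ z ∈ ball x₀ R, ∀ i, fderiv ℝ (fun y => u y r) z (EuclideanSpace.single i 1)
            = dd (eb i) U (z, r) := fun z hz i => slice_x (hUd (z, r) ⟨hz, hq.2⟩) _
        have e3 : ∀ i, fderiv ℝ (fun z => fderiv ℝ (fun y => u y r) z (EuclideanSpace.single i 1))
            y (EuclideanSpace.single i 1) = dd (eb i) (dd (eb i) U) (y, r) := by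
          intro i
          have hev : (fun z => fderiv ℝ (fun y => u y r) z (EuclideanSpace.single i 1))
              =ᶠ[𝓝 y] fun z => dd (eb i) U (z, r) := by
            filter_upwards [isOpen_ball.mem_nhds hq.1] with z hz using e2 z hz i
          rw [hev.fderiv_eq]
          exact slice_x (hUdi _ _ hq) _
        have e4 : ∀ i, dd (eb i) (fun q : EuclideanSpace ℝ (Fin n) × ℝ => f q.1) (y, r)
            = fderiv ℝ f y (EuclideanSpace.single i 1) := fun i =>
          dd_fst _ _ (y, r) ((hf3.differentiable (by norm_num)) _)
        simp only [e3, e2 y hq.1, e4]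
        simp only [hU]
        ring
    have hpos : t' - (t₀ - T) ≠ 0 := by linarith [ht'.1]
    have hcont : ContinuousAt (fun s : ℝ => 9 * D * (E + (t' - s)⁻¹) * u x t') (t₀ - T) := by
      have : ContinuousAt (fun s : ℝ => (t' - s)⁻¹) (t₀ - T) :=
        ContinuousAt.inv₀ (by fun_prop) hpos
      fun_prop
    have hlim := hcont.tendsto.mono_left (nhdsWithin_le_nhds (s := Ioi (t₀ - T)))
    apply ge_of_tendsto hlim
    filter_upwards [Ioo_mem_nhdsGT ht'.1] with s hs' using hs s hs'
  -- all times
  have hall : ‖gradient (fun y => u y t) x‖ ^ 2 ≤ 9 * D * (E + (t - (t₀ - T))⁻¹) * u x t := by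
    rcases lt_or_eq_of_le ht.2 with h | h
    · exact hinterior t ⟨ht.1, h⟩
    · subst h
      have hTt : t - T < t := by linarith
      have c1 : Tendsto (fun t' => ‖gradient (fun y => u y t') x‖ ^ 2) (𝓝[<] t)
          (𝓝 (‖gradient (fun y => u y t) x‖ ^ 2)) := by
        have h1 := (grad_cont hTt hu3 hxR).pow 2 t (right_mem_Icc.2 hTt.le)
        have h2 := h1.mono (Ioo_subset_Icc_self)
        have h3 := h2.tendsto
        rwa [nhdsWithin_Ioo_eq_nhdsLT hTt] at h3
      have c2 : Tendsto (fun t' => 9 * D * (E + (t' - (t - T))⁻¹) * u x t') (𝓝[<] t)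
          (𝓝 (9 * D * (E + (t - (t - T))⁻¹) * u x t)) := by
        have h1 : ContinuousOn (fun t' => u x t') (Icc (t - T) t) :=
          hu3.continuousOn.comp (f := fun t' : ℝ => (x, t')) (by fun_prop)
            (fun r hr => ⟨hxR, hr⟩)
        have h2 := (h1 t (right_mem_Icc.2 hTt.le)).mono Ioo_subset_Icc_self
        have h3 := h2.tendsto
        rw [nhdsWithin_Ioo_eq_nhdsLT hTt] at h3
        have hne : t - (t - T) ≠ 0 := by linarith
        have h4 : ContinuousAt (fun s : ℝ => 9 * D * (E + (s - (t - T))⁻¹)) t := by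
          have : ContinuousAt (fun s : ℝ => (s - (t - T))⁻¹) t :=
            ContinuousAt.inv₀ (by fun_prop) hne
          fun_prop
        exact (h4.tendsto.mono_left nhdsWithin_le_nhds).mul h3
      apply le_of_tendsto_of_tendsto c1 c2
      filter_upwards [Ioo_mem_nhdsLT hTt] with s hs using hinterior s hs
  -- conclusion
  have hu0 : 0 < u x t := lt_of_lt_of_le hδ (hub x hxR t (Ioc_subset_Icc_self ht)).1
  have hτ : 0 < t - t₀ + T := by linarith [ht.1]
  have hτe : t - (t₀ - T) = t - t₀ + T := by ring
  rw [hτe] at hall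
  apply le_of_sq_le_sq _ (by positivity)
  rw [div_pow, Real.sq_sqrt hu0.le, div_le_iff₀ hu0]
  refine hall.trans (mul_le_mul_of_nonneg_right ?_ hu0.le)
  rw [mul_pow, mul_pow, mul_pow, Real.sq_sqrt (by positivity), Real.sq_sqrt hD.le]
  have q1 : (1 / R) ^ 2 = 1 / R ^ 2 := by ring
  have q2 : Real.sqrt (|α| / R) ^ 2 = |α| / R := Real.sq_sqrt (by positivity)
  have q3 : (1 / Real.sqrt (t - t₀ + T)) ^ 2 = (t - t₀ + T)⁻¹ := by
    rw [div_pow, Real.sq_sqrt hτ.le]; simp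
  have q4 : Real.sqrt K ^ 2 = K := Real.sq_sqrt hK
  have q5 : Real.sqrt c₂ ^ 2 = c₂ := Real.sq_sqrt hc0
  have p1 : 0 ≤ 1 / R := by positivity
  have p2 : 0 ≤ Real.sqrt (|α| / R) := Real.sqrt_nonneg _
  have p3 : 0 ≤ 1 / Real.sqrt (t - t₀ + T) := by positivity
  have p4 : 0 ≤ Real.sqrt K := Real.sqrt_nonneg _
  have p5 : 0 ≤ Real.sqrt c₂ := Real.sqrt_nonneg _
  have hy : 0 ≤ (t - t₀ + T)⁻¹ := by positivity
  have hsum : 1 / R ^ 2 + |α| / R + (t - t₀ + T)⁻¹ + K + c₂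
      ≤ (1 / R + Real.sqrt (|α| / R) + 1 / Real.sqrt (t - t₀ + T) + Real.sqrt K
        + Real.sqrt c₂) ^ 2 := by
    rw [← q1, ← q3]
    nth_rewrite 1 [← q2, ← q4, ← q5]
    generalize 1 / R = A1 at *
    generalize Real.sqrt (|α| / R) = A2 at *
    generalize 1 / Real.sqrt (t - t₀ + T) = A3 at *
    generalize Real.sqrt K = A4 at *
    generalize Real.sqrt c₂ = A5 at *
    have : 0 ≤ A1 * A2 + A1 * A3 + A1 * A4 + A1 * A5 + A2 * A3 + A2 * A4 + A2 * A5 + A3 * A4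
      + A3 * A5 + A4 * A5 := by positivity
    nlinarith
  have hEle : E + (t - t₀ + T)⁻¹
      ≤ 3000 * n * (1 / R ^ 2 + |α| / R + (t - t₀ + T)⁻¹ + K + c₂) := by
    rw [hE]
    nlinarith
  have hfin := mul_le_mul_of_nonneg_left hsum (show (0:ℝ) ≤ 3000 * n by positivity)
  calc 9 * D * (E + (t - t₀ + T)⁻¹) ≤ 9 * D * (3000 * n * (1 / R + Real.sqrt (|α| / R)
      + 1 / Real.sqrt (t - t₀ + T) + Real.sqrt K + Real.sqrt c₂) ^ 2) := by
        gcongr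
        exact hEle.trans hfin
    _ = _ := by ring
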